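/- Let a, b ∈ (0,∞) and let f ∈ 𝓕 be a solution of the functional equation f(t) = f(at) + f(bt) for all t ≥ 0. Then f(t) = 0 if and only if t = 0; that is, f has no zeros in (0,∞). -/

import Mathlib

/-- `𝓕`: continuous functions `f : [0,∞) → ℝ` with `f 0 = 0` and `0` an isolated
point of the zero set `{x ≥ 0 : f x = 0}`. -/
def MemClassF (f : ℝ → ℝ) : Prop :=
  ContinuousOn f (Set.Ici 0) ∧ f 0 = 0 ∧ ∃ u > (0:ℝ), ∀ x, 0 < x → x < u → f x ≠ 0

open Filter Topology in
/-- If `f` is positive near `0`, tends to `0` at `0` and `f t = f (a * t) + f (b * t)`,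
then `b < 1`: otherwise `f t > f (b * t)` near `0`. -/
theorem lt_one_of_eq_add_of_pos {a b u : ℝ} (ha : 0 < a) (hb : 0 < b) (hu : 0 < u) {f : ℝ → ℝ}
    (hf : ContinuousWithinAt f (Set.Ici 0) 0) (h0 : f 0 = 0)
    (hpos : ∀ x, 0 < x → x < u → 0 < f x)
    (heq : ∀ t : ℝ, 0 ≤ t → f t = f (a * t) + f (b * t)) : b < 1 := by
  by_contra! hb1
  obtain ⟨x, hx, hxu, hax⟩ : ∃ x, 0 < x ∧ x < u ∧ a * x < u := by
    refine ⟨u / (a + 2), by positivity, ?_, ?_⟩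
    · rw [div_lt_iff₀ (by positivity)]; nlinarith
    · rw [mul_div_assoc', div_lt_iff₀ (by positivity)]; nlinarith
  have hstep : ∀ t, 0 < t → t ≤ x → f (b * t) < f t := by
    intro t ht htx
    have := hpos (a * t) (by positivity) (by nlinarith)
    linarith [heq t ht.le]
  rcases hb1.eq_or_lt with rfl | hb1
  · simpa using hstep x hx le_rfl
  have hle : ∀ n : ℕ, f x ≤ f (x * b⁻¹ ^ n) := by
    intro n
    induction n with
    | zero => simp
    | succ n ih =>
      have h1 : x * b⁻¹ ^ (n + 1) ≤ x :=
        mul_le_of_le_one_right hx.le (pow_le_one₀ (by positivity) (inv_le_one_of_one_le₀ hb1.le))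
      have h2 := hstep (x * b⁻¹ ^ (n + 1)) (by positivity) h1
      have h3 : b * (x * b⁻¹ ^ (n + 1)) = x * b⁻¹ ^ n := by
        rw [pow_succ]; field_simp
      rw [h3] at h2
      linarith
  have hlim : Tendsto (fun n : ℕ => x * b⁻¹ ^ n) atTop (𝓝[Set.Ici 0] 0) := by
    refine tendsto_nhdsWithin_iff.2 ⟨?_, Eventually.of_forall fun n => ?_⟩
    · simpa using (tendsto_pow_atTop_nhds_zero_of_lt_one (by positivity)
        (inv_lt_one_of_one_lt₀ hb1)).const_mul x
    · exact Set.mem_Ici.2 (by positivity)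
  have := ge_of_tendsto' (hf.tendsto.comp hlim) hle
  linarith [hpos x hx hxu]

/-- A solution of `f t = f (a * t) + f (b * t)` that is positive near `0` and tends to `0` at `0`
is positive on `(0, ∞)`. -/
theorem pos_of_eq_add_of_pos {a b u : ℝ} (ha : 0 < a) (hb : 0 < b) (hu : 0 < u) {f : ℝ → ℝ}
    (hf : ContinuousWithinAt f (Set.Ici 0) 0) (h0 : f 0 = 0)
    (hpos : ∀ x, 0 < x → x < u → 0 < f x)
    (heq : ∀ t : ℝ, 0 ≤ t → f t = f (a * t) + f (b * t)) {t : ℝ} (ht : 0 < t) : 0 < f t := by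
  have hb1 := lt_one_of_eq_add_of_pos ha hb hu hf h0 hpos heq
  have ha1 := lt_one_of_eq_add_of_pos hb ha hu hf h0 hpos fun t ht => by
    rw [heq t ht, add_comm]
  set c := max a b
  have hc0 : 0 < c := lt_max_of_lt_left ha
  have key : ∀ (n : ℕ) (t : ℝ), 0 < t → c ^ n * t < u → 0 < f t := by
    intro n
    induction n with
    | zero => intro t ht h; exact hpos t ht (by simpa using h)
    | succ n ih =>
      intro t ht h
      have hscale : ∀ d, 0 < d → d ≤ c → 0 < f (d * t) := fun d hd hdc =>
        ih (d * t) (by positivity) (lt_of_le_of_lt (by rw [pow_succ, mul_assoc]; gcongr) h)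
      rw [heq t ht.le]
      exact add_pos (hscale a ha (le_max_left a b)) (hscale b hb (le_max_right a b))
  obtain ⟨n, hn⟩ := exists_pow_lt_of_lt_one (div_pos hu ht) (max_lt ha1 hb1)
  exact key n t ht ((lt_div_iff₀ ht).1 hn)

theorem stmt_3 (a b : ℝ) (ha : 0 < a) (hb : 0 < b) (f : ℝ → ℝ)
    (hf : MemClassF f) (heq : ∀ t : ℝ, 0 ≤ t → f t = f (a * t) + f (b * t)) :
    ∀ t : ℝ, 0 ≤ t → (f t = 0 ↔ t = 0) := by
  obtain ⟨hc, h0, u, hu, hne⟩ := hf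
  intro t ht
  refine ⟨fun hft => ?_, fun h => h ▸ h0⟩
  by_contra htne
  have htpos : 0 < t := lt_of_le_of_ne ht (Ne.symm htne)
  have hc0 : ContinuousWithinAt f (Set.Ici 0) 0 := hc 0 Set.self_mem_Ici
  by_cases hpos : ∀ x, 0 < x → x < u → 0 < f x
  · exact (pos_of_eq_add_of_pos ha hb hu hc0 h0 hpos heq htpos).ne' hft
  · push Not at hpos
    obtain ⟨y, hy, hyu, hfy⟩ := hpos
    have hneg : ∀ x, 0 < x → x < u → 0 < -f x := by
      intro x hx hxu
      by_contra! hfx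
      obtain ⟨z, hz, hfz⟩ := isPreconnected_Ioo.intermediate_value
        (Set.mem_Ioo.2 ⟨hy, hyu⟩) (Set.mem_Ioo.2 ⟨hx, hxu⟩)
        (hc.mono fun z hz => Set.mem_Ici.2 hz.1.le) (Set.mem_Icc.2 ⟨hfy, neg_nonpos.1 hfx⟩)
      exact hne z hz.1 hz.2 hfz
    have := pos_of_eq_add_of_pos (f := fun x => -f x) ha hb hu hc0.neg (by simp [h0]) hneg
      (fun s hs => by rw [heq s hs, neg_add]) htpos
    simp [hft] at this
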